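/- arXiv:2008.08392 — 2 statements merged into one kernel-verified Lean document; each statement's English description precedes it below -/
import Mathlib

section
/- Among the 990 unordered pairs of distinct singular classes, exactly 720 are contained in no *-set, and the remaining 270 are each contained in exactly one *-set; in particular no pair is contained in more than one *-set. -/
open Matrix

noncomputable section

/-- Gram matrix of the even lattice `2U(3) ⊕ A₂`. -/
def GramB : Matrix (Fin 6) (Fin 6) ℚ :=
  !![0,0,0,0,0,3; 0,0,0,0,3,0; 0,0,2,1,0,0; 0,0,1,2,0,0; 0,3,0,0,0,0; 3,0,0,0,0,0]

/-- The bilinear form on `V = ℚ⁶` with Gram matrix `GramB`. -/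
def BB (x y : Fin 6 → ℚ) : ℚ := x ⬝ᵥ GramB.mulVec y

/-- The lattice `M = ℤ⁶ ⊆ ℚ⁶`. -/
def MB : AddSubgroup (Fin 6 → ℚ) where
  carrier := {x | ∀ i, ∃ n : ℤ, x i = (n : ℚ)}
  zero_mem' := fun i => ⟨0, by simp⟩
  add_mem' := by
    intro a b ha hb i
    obtain ⟨n, hn⟩ := ha i
    obtain ⟨m, hm⟩ := hb i
    exact ⟨n + m, by simp [hn, hm]⟩
  neg_mem' := by
    intro a ha i
    obtain ⟨n, hn⟩ := ha i
    exact ⟨-n, by simp [hn]⟩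

/-- The dual lattice `M^∨ = {x ∈ V : B(x,m) ∈ ℤ for all m ∈ M}`. -/
def MBdual : Set (Fin 6 → ℚ) := {x | ∀ m ∈ MB, ∃ n : ℤ, BB x m = (n : ℚ)}

/-- The quotient `V/M` (containing the discriminant group `M^∨/M`). -/
abbrev QB := (Fin 6 → ℚ) ⧸ MB

/-- The projection `V → V/M`. -/
def pB : (Fin 6 → ℚ) → QB := QuotientAddGroup.mk

/-- A singular class: an unordered pair `{v+M, −v+M}` of cosets of order 3 in `M^∨/M`
with a representative `v` satisfying `B(v,v) = 2/3`. -/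
def IsSingular (c : Sym2 QB) : Prop :=
  ∃ v : Fin 6 → ℚ, v ∈ MBdual ∧ addOrderOf (pB v) = 3 ∧ BB v v = 2/3 ∧
    c = s(pB v, pB (-v))

/-- The reflection `σ_v(x) = x − 3·B(v,x)·v` (for `B(v,v) = 2/3`). -/
def reflB (v x : Fin 6 → ℚ) : Fin 6 → ℚ := x - (3 * BB v x) • v

/-- A `*`-set: five distinct singular classes such that `σ_v(v') ∈ (v'+M) ∪ (−v'+M)`
whenever `v, v' ∈ M^∨` have `B(v,v) = B(v',v') = 2/3` and represent cosets of
(possibly equal) classes of the set. -/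
def IsStarSetB (S : Set (Sym2 QB)) : Prop :=
  S.ncard = 5 ∧ (∀ c ∈ S, IsSingular c) ∧
  ∀ v v' : Fin 6 → ℚ, v ∈ MBdual → v' ∈ MBdual →
    BB v v = 2/3 → BB v' v' = 2/3 →
    (∃ c ∈ S, pB v ∈ c) → (∃ c' ∈ S, pB v' ∈ c') →
    (reflB v v' - v' ∈ MB ∨ reflB v v' + v' ∈ MB)

/-- An unordered pair of distinct singular classes. -/
def IsPairB (P : Set (Sym2 QB)) : Prop :=
  ∃ c₁ c₂ : Sym2 QB, IsSingular c₁ ∧ IsSingular c₂ ∧ c₁ ≠ c₂ ∧ P = {c₁, c₂}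

/-- The number of `*`-sets containing a given pair. -/
def nStarB (P : Set (Sym2 QB)) : ℕ :=
  {S : Set (Sym2 QB) | IsStarSetB S ∧ P ⊆ S}.ncard

def wI : Fin 45 → Fin 6 → ℤ := ![
  ![0, 0, 1, 1, 0, 0],
  ![0, 0, 1, 1, 0, 1],
  ![0, 0, 1, 1, 0, -1],
  ![0, 0, 1, 1, 1, 0],
  ![0, 0, 1, 1, 1, 1],
  ![0, 0, 1, 1, 1, -1],
  ![0, 0, 1, 1, -1, 0],
  ![0, 0, 1, 1, -1, 1],
  ![0, 0, 1, 1, -1, -1],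
  ![0, 1, 0, 0, 1, 0],
  ![0, 1, 0, 0, 1, 1],
  ![0, 1, 0, 0, 1, -1],
  ![0, 1, 1, 1, 0, 0],
  ![0, 1, 1, 1, 0, 1],
  ![0, 1, 1, 1, 0, -1],
  ![0, 1, -1, -1, 0, 0],
  ![0, 1, -1, -1, 0, 1],
  ![0, 1, -1, -1, 0, -1],
  ![1, 0, 0, 0, 0, 1],
  ![1, 0, 0, 0, 1, 1],
  ![1, 0, 0, 0, -1, 1],
  ![1, 0, 1, 1, 0, 0],
  ![1, 0, 1, 1, 1, 0],
  ![1, 0, 1, 1, -1, 0],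
  ![1, 0, -1, -1, 0, 0],
  ![1, 0, -1, -1, 1, 0],
  ![1, 0, -1, -1, -1, 0],
  ![1, 1, 0, 0, 0, 1],
  ![1, 1, 0, 0, 1, 0],
  ![-2, 1, 0, 0, -1, -1],
  ![1, 1, 1, 1, 0, 0],
  ![1, 1, 1, 1, 1, -1],
  ![1, 1, 1, 1, -1, 1],
  ![1, 1, -1, -1, 0, 0],
  ![1, 1, -1, -1, 1, -1],
  ![1, 1, -1, -1, -1, 1],
  ![1, -1, 0, 0, 0, 1],
  ![-2, -1, 0, 0, 1, -1],
  ![1, -1, 0, 0, -1, 0],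
  ![1, -1, 1, 1, 0, 0],
  ![1, -1, 1, 1, 1, 1],
  ![1, -1, 1, 1, -1, -1],
  ![1, -1, -1, -1, 0, 0],
  ![1, -1, -1, -1, 1, 1],
  ![1, -1, -1, -1, -1, -1]]

def maskI : Fin 45 → ℕ := ![
  481977699840, 3855821573632, 30846572563968, 30793843634176, 541180588032,
  3849347690496, 3908422303744, 30787280011264, 488670199808, 10072254316551,
  5036194136071, 20075923374087, 18797130154040, 9639553925176, 6747687747640,
  11085487014336, 5783732355520, 18315152458176, 19948512514633, 5261469304905,
  9974256313417, 18988318990994, 6701759666322, 9494159475858, 11306769924900,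
  18224083151140, 5653385057572, 10170558617761, 19859948848289, 5085279363745,
  11132627724554, 18416845264138, 5566313841418, 18829179701332, 6872017183828,
  9414589944404, 38961976593, 10276455185, 19481045265, 37086700642,
  13089444450, 18543331426, 22083617932, 35593953932, 11041904780]


/-- Adjacency (orthogonality) of two classes. -/
def adjI (i j : Fin 45) : Bool := Nat.testBit (maskI i) j.val

def vecI (a : Fin 6 → ℤ) : Fin 6 → ℚ := fun i => (a i : ℚ) / 3

def redI (a : Fin 6 → ℤ) : Fin 6 → ZMod 3 := fun i => (a i : ZMod 3)

def betaI (x y : Fin 6 → ZMod 3) : ZMod 3 :=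
  x 0 * y 5 + x 5 * y 0 + x 1 * y 4 + x 4 * y 1 + 2 * (x 2 * y 2)

def FI (x y : Fin 6 → ZMod 3) : Prop :=
  (∀ k, betaI x y * x k = 0) ∨ (∀ k, 2 * y k - betaI x y * x k = 0)

instance (x y : Fin 6 → ZMod 3) : Decidable (FI x y) := by unfold FI; infer_instance

theorem wI_dual : ∀ i, redI (wI i) 2 = redI (wI i) 3 := by decide +kernel

theorem wI_norm : ∀ i, 6 * (wI i 0 * wI i 5 + wI i 1 * wI i 4)
    + 2 * (wI i 2 * wI i 2 + wI i 2 * wI i 3 + wI i 3 * wI i 3) = 6 := by decide +kernel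

theorem wI_ne : ∀ i, redI (wI i) ≠ 0 := by decide +kernel

theorem wI_inj : ∀ i j, redI (wI i) = redI (wI j) ∨ redI (wI i) = - redI (wI j) → i = j := by
  decide +kernel

theorem wI_class : ∀ x0 x1 x2 x4 x5 : ZMod 3, x0 * x5 + x1 * x4 + x2 * x2 = 1 →
    ∃ i, ![x0, x1, x2, x2, x4, x5] = redI (wI i) ∨ ![x0, x1, x2, x2, x4, x5] = - redI (wI i) := by
  decide +kernel

theorem adjI_beta : ∀ i j, adjI i j = true ↔ i ≠ j ∧ betaI (redI (wI i)) (redI (wI j)) = 0 := by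
  decide +kernel

theorem beta_self : ∀ i, betaI (redI (wI i)) (redI (wI i)) = 2 := by
  decide +kernel

theorem FI_adj (i j : Fin 45) (hij : i ≠ j) (h : FI (redI (wI i)) (redI (wI j))) :
    adjI i j = true := by
  rw [adjI_beta]
  refine ⟨hij, ?_⟩
  rcases h with h | h
  · have : Fact (Nat.Prime 3) := ⟨by norm_num⟩
    by_contra hb
    apply wI_ne i
    funext k
    exact (mul_eq_zero.1 (h k)).resolve_left hb
  · have h3 : (3 : ZMod 3) = 0 := by decide
    have hc : ∀ b : ZMod 3, b = 0 ∨ b = 1 ∨ b = 2 := by decide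
    rcases hc (betaI (redI (wI i)) (redI (wI j))) with hb | hb | hb
    · exact hb
    · refine absurd (wI_inj i j (Or.inr ?_)) hij
      funext k
      have := h k
      rw [hb] at this
      simp only [Pi.neg_apply]
      linear_combination - this + redI (wI j) k * h3
    · refine absurd (wI_inj i j (Or.inl ?_)) hij
      funext k
      have := h k
      rw [hb] at this
      linear_combination this + (redI (wI i) k - redI (wI j) k) * h3

theorem adjI_symm : ∀ i j, adjI i j = true → adjI j i = true := by decide +kernel

def lineI (i j : Fin 45) : Finset (Fin 45) :=
  Finset.univ.filter (fun k => k = i ∨ k = j ∨ (adjI i k = true ∧ adjI j k = true))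

theorem lineI_card : ∀ i j, adjI i j = true → (lineI i j).card = 5 := by decide +kernel

theorem mask_clique : ∀ i j, adjI i j = true → ∀ k, adjI i k = true → adjI j k = true →
    (maskI i &&& maskI j) ||| (maskI k ||| 2 ^ k.val) = maskI k ||| 2 ^ k.val := by
  decide +kernel

theorem lineI_clique0 (i j : Fin 45) (h : adjI i j = true) (k : Fin 45)
    (hk : adjI i k = true ∧ adjI j k = true) (l : Fin 45)
    (hl : adjI i l = true ∧ adjI j l = true) (hkl : k ≠ l) : adjI k l = true := by
  have e := congrArg (fun n => Nat.testBit n l.val) (mask_clique i j h k hk.1 hk.2)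
  simp only [adjI] at hl ⊢
  have hne : k.val ≠ l.val := fun h => hkl (Fin.ext h)
  simpa [Nat.testBit_or, Nat.testBit_and, hl.1, hl.2, Nat.testBit_two_pow, hne] using e

theorem count_all : ((Finset.univ : Finset (Fin 45 × Fin 45)).filter
    (fun p => p.1 < p.2)).card = 990 := by decide +kernel

theorem count_adj : ((Finset.univ : Finset (Fin 45 × Fin 45)).filter
    (fun p => p.1 < p.2 ∧ adjI p.1 p.2 = true)).card = 270 := by decide +kernel

theorem count_nadj : ((Finset.univ : Finset (Fin 45 × Fin 45)).filter
    (fun p => p.1 < p.2 ∧ ¬ adjI p.1 p.2 = true)).card = 720 := by decide +kernel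

theorem vecI_sub_mem (a b : Fin 6 → ℤ) : vecI a - vecI b ∈ MB ↔ redI a = redI b := by
  constructor
  · intro h
    funext k
    obtain ⟨n, hn⟩ := h k
    simp only [vecI, Pi.sub_apply] at hn
    have h1 : (a k : ℚ) - b k = 3 * n := by linarith
    have h2 : a k - b k = 3 * n := by exact_mod_cast h1
    have h3 : ((a k - b k : ℤ) : ZMod 3) = 0 := by
      rw [h2]; exact (ZMod.intCast_zmod_eq_zero_iff_dvd _ 3).2 ⟨n, by simp⟩
    push_cast at h3
    exact sub_eq_zero.1 h3
  · intro h k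
    have h1 := congrFun h k
    simp only [redI] at h1
    have h3 : ((a k - b k : ℤ) : ZMod 3) = 0 := by push_cast; exact sub_eq_zero.2 h1
    obtain ⟨n, hn⟩ := (ZMod.intCast_zmod_eq_zero_iff_dvd _ 3).1 h3
    refine ⟨n, ?_⟩
    have h2 : (a k : ℚ) - b k = 3 * n := by exact_mod_cast hn
    simp only [vecI, Pi.sub_apply]
    linarith

theorem pB_eq (a b : Fin 6 → ℤ) : pB (vecI a) = pB (vecI b) ↔ redI a = redI b := by
  rw [eq_comm (a := redI a), ← vecI_sub_mem, pB, QuotientAddGroup.eq, neg_add_eq_sub]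

theorem neg_vecI (a : Fin 6 → ℤ) : - vecI a = vecI (-a) := by
  funext k; simp [vecI, neg_div]

theorem redI_neg (a : Fin 6 → ℤ) : redI (-a) = - redI a := by
  funext k; simp [redI]

theorem BB_eq (x y : Fin 6 → ℚ) : BB x y = 3 * (x 0 * y 5 + x 5 * y 0 + x 1 * y 4 + x 4 * y 1)
    + (2 * (x 2 * y 2) + x 2 * y 3 + x 3 * y 2 + 2 * (x 3 * y 3)) := by
  simp only [BB, GramB, dotProduct, mulVec, Fin.sum_univ_six]
  simp
  ring

theorem single_mem (k : Fin 6) : (Pi.single k 1 : Fin 6 → ℚ) ∈ MB := by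
  intro i
  by_cases h : i = k
  · subst h; exact ⟨1, by simp⟩
  · exact ⟨0, by simp [h]⟩

theorem dual_iff (v : Fin 6 → ℚ) :
    v ∈ MBdual ↔ ∃ a : Fin 6 → ℤ, v = vecI a ∧ redI a 2 = redI a 3 := by
  constructor
  · intro h
    have hs := fun k => h _ (single_mem k)
    simp only [BB_eq] at hs
    obtain ⟨n0, h0⟩ := hs 0
    obtain ⟨n1, h1⟩ := hs 1
    obtain ⟨n2, h2⟩ := hs 2
    obtain ⟨n3, h3⟩ := hs 3
    obtain ⟨n4, h4⟩ := hs 4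
    obtain ⟨n5, h5⟩ := hs 5
    simp at h0 h1 h2 h3 h4 h5
    refine ⟨![n5, n4, 2 * n2 - n3, 2 * n3 - n2, n1, n0], ?_, ?_⟩
    · funext k
      fin_cases k <;> simp [vecI] <;> linarith
    · simp only [redI]
      simp
      have : (3 : ZMod 3) = 0 := by decide
      linear_combination (n2 - n3 : ZMod 3) * this
  · rintro ⟨a, rfl, ha⟩ m hm
    choose n hn using hm
    have h3 : ((a 2 - a 3 : ℤ) : ZMod 3) = 0 := by push_cast; exact sub_eq_zero.2 ha
    obtain ⟨t, ht⟩ := (ZMod.intCast_zmod_eq_zero_iff_dvd _ 3).1 h3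
    have ht' : (a 2 : ℚ) = a 3 + 3 * t := by
      have : (a 2 : ℚ) - a 3 = 3 * t := by exact_mod_cast ht
      linarith
    refine ⟨a 0 * n 5 + a 5 * n 0 + a 1 * n 4 + a 4 * n 1 + (a 3 + 2 * t) * n 2
      + (a 3 + t) * n 3, ?_⟩
    rw [BB_eq]
    simp only [vecI, hn, ht']
    push_cast
    ring

/-- Integral form of `3 B`. -/
theorem BB_vec (a b : Fin 6 → ℤ) (ha : redI a 2 = redI a 3) (hb : redI b 2 = redI b 3) :
    ∃ c : ℤ, 3 * BB (vecI a) (vecI b) = c ∧ (c : ZMod 3) = betaI (redI a) (redI b) := by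
  have h3 : ((a 3 - a 2 : ℤ) : ZMod 3) = 0 := by push_cast; exact sub_eq_zero.2 ha.symm
  obtain ⟨t, ht⟩ := (ZMod.intCast_zmod_eq_zero_iff_dvd _ 3).1 h3
  have h4 : ((b 3 - b 2 : ℤ) : ZMod 3) = 0 := by push_cast; exact sub_eq_zero.2 hb.symm
  obtain ⟨s, hs⟩ := (ZMod.intCast_zmod_eq_zero_iff_dvd _ 3).1 h4
  have ht' : (a 3 : ℚ) = a 2 + 3 * t := by
    have : (a 3 : ℚ) - a 2 = 3 * t := by exact_mod_cast ht
    linarith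
  have hs' : (b 3 : ℚ) = b 2 + 3 * s := by
    have : (b 3 : ℚ) - b 2 = 3 * s := by exact_mod_cast hs
    linarith
  refine ⟨a 0 * b 5 + a 5 * b 0 + a 1 * b 4 + a 4 * b 1 + 2 * (a 2 * b 2)
    + 3 * (a 2 * s + t * b 2 + 2 * (t * s)), ?_, ?_⟩
  · rw [BB_eq]
    simp only [vecI, ht', hs']
    push_cast
    ring
  · have : (3 : ZMod 3) = 0 := by decide
    simp only [betaI, redI]
    push_cast
    rw [this]
    ring

theorem norm_red (a : Fin 6 → ℤ) (ha : redI a 2 = redI a 3) (h : BB (vecI a) (vecI a) = 2/3) :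
    ∃ i, redI a = redI (wI i) ∨ redI a = - redI (wI i) := by
  obtain ⟨c, hc, hc'⟩ := BB_vec a a ha ha
  rw [h] at hc
  have hc2 : c = 2 := by
    have : (c : ℚ) = 2 := by rw [← hc]; norm_num
    exact_mod_cast this
  subst hc2
  have key := wI_class (redI a 0) (redI a 1) (redI a 2) (redI a 4) (redI a 5) (by
    have h2 : (2 : ZMod 3) * 2 = 1 := by decide
    simp only [betaI] at hc'
    push_cast at hc'
    linear_combination (-2 : ZMod 3) * hc' + (1 - redI a 0 * redI a 5 - redI a 1 * redI a 4
      - redI a 2 * redI a 2) * h2)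
  have e : ![redI a 0, redI a 1, redI a 2, redI a 2, redI a 4, redI a 5] = redI a := by
    funext k
    fin_cases k <;> simp [ha]
  rwa [e] at key

theorem refl_iff (a b : Fin 6 → ℤ) (ha : redI a 2 = redI a 3) (hb : redI b 2 = redI b 3) :
    (reflB (vecI a) (vecI b) - vecI b ∈ MB ∨ reflB (vecI a) (vecI b) + vecI b ∈ MB) ↔
      FI (redI a) (redI b) := by
  obtain ⟨c, hc, hc'⟩ := BB_vec a b ha hb
  have e1 : reflB (vecI a) (vecI b) - vecI b = vecI (fun k => - (c * a k)) - vecI 0 := by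
    funext k
    simp [reflB, hc, vecI]
    ring
  have e2 : reflB (vecI a) (vecI b) + vecI b = vecI (fun k => 2 * b k - c * a k) - vecI 0 := by
    funext k
    simp [reflB, hc, vecI]
    ring
  rw [e1, e2, vecI_sub_mem, vecI_sub_mem, FI, ← hc', funext_iff, funext_iff]
  simp [redI]

theorem BB_w (i : Fin 45) : BB (vecI (wI i)) (vecI (wI i)) = 2/3 := by
  have h := wI_norm i
  have h' : (6 * (wI i 0 * wI i 5 + wI i 1 * wI i 4)
    + 2 * (wI i 2 * wI i 2 + wI i 2 * wI i 3 + wI i 3 * wI i 3) : ℚ) = 6 := by exact_mod_cast h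
  rw [BB_eq]
  simp only [vecI]
  linarith

theorem w_dual (i : Fin 45) : vecI (wI i) ∈ MBdual := (dual_iff _).2 ⟨_, rfl, wI_dual i⟩

theorem w_order (i : Fin 45) : addOrderOf (pB (vecI (wI i))) = 3 := by
  have : Fact (Nat.Prime 3) := ⟨by norm_num⟩
  apply addOrderOf_eq_prime
  · rw [pB, ← QuotientAddGroup.mk_nsmul, QuotientAddGroup.eq_zero_iff]
    intro k
    exact ⟨wI i k, by simp [vecI]; ring⟩
  · intro h
    have h0 : pB (vecI (wI i)) = pB (vecI 0) := by
      rw [h]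
      have : vecI 0 = 0 := by funext k; simp [vecI]
      rw [this]; rfl
    rw [pB_eq] at h0
    apply wI_ne i
    rw [h0]
    funext k; simp [redI]

/-- The 45 singular classes. -/
def eI (i : Fin 45) : Sym2 QB := s(pB (vecI (wI i)), pB (-vecI (wI i)))

theorem mem_eI (a : Fin 6 → ℤ) (i : Fin 45) :
    pB (vecI a) ∈ eI i ↔ redI a = redI (wI i) ∨ redI a = - redI (wI i) := by
  rw [eI, Sym2.mem_iff, neg_vecI, pB_eq, pB_eq, redI_neg]

theorem eI_inj : Function.Injective eI := by
  intro i j h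
  apply wI_inj
  rw [← mem_eI, ← h, mem_eI]
  exact Or.inl rfl

theorem singular_iff (c : Sym2 QB) : IsSingular c ↔ ∃ i, c = eI i := by
  constructor
  · rintro ⟨v, hv, -, hn, rfl⟩
    obtain ⟨a, rfl, ha⟩ := (dual_iff v).1 hv
    obtain ⟨i, hi⟩ := norm_red a ha hn
    refine ⟨i, ?_⟩
    rw [eI, neg_vecI, neg_vecI]
    rcases hi with hi | hi
    · rw [(pB_eq a (wI i)).2 hi, (pB_eq (-a) (-wI i)).2 (by rw [redI_neg, redI_neg, hi])]
    · rw [(pB_eq a (-wI i)).2 (by rw [redI_neg, hi]),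
        (pB_eq (-a) (wI i)).2 (by rw [redI_neg, hi, neg_neg]), Sym2.eq_swap]
  · rintro ⟨i, rfl⟩
    exact ⟨_, w_dual i, w_order i, BB_w i, rfl⟩

theorem beta_neg_left (x y : Fin 6 → ZMod 3) : betaI (-x) y = - betaI x y := by
  simp only [betaI, Pi.neg_apply]; ring

theorem beta_neg_right (x y : Fin 6 → ZMod 3) : betaI x (-y) = - betaI x y := by
  simp only [betaI, Pi.neg_apply]; ring

theorem star_iff (S : Set (Sym2 QB)) : IsStarSetB S ↔
    ∃ T : Finset (Fin 45), T.card = 5 ∧ (∀ i ∈ T, ∀ j ∈ T, i ≠ j → adjI i j = true) ∧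
      S = eI '' (T : Set (Fin 45)) := by
  constructor
  · rintro ⟨hc, hs, hr⟩
    have hS : S = eI '' (eI ⁻¹' S) := by
      symm
      rw [Set.image_preimage_eq_iff]
      intro c hcS
      obtain ⟨i, rfl⟩ := (singular_iff c).1 (hs c hcS)
      exact ⟨i, rfl⟩
    have hfin : (eI ⁻¹' S).Finite := Set.toFinite _
    refine ⟨hfin.toFinset, ?_, ?_, ?_⟩
    · rw [← Set.ncard_eq_toFinset_card _ hfin, ← Set.ncard_image_of_injective _ eI_inj, ← hS, hc]
    · intro i hi j hj hij
      simp only [Set.Finite.mem_toFinset, Set.mem_preimage] at hi hj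
      apply FI_adj i j hij
      rw [← refl_iff _ _ (wI_dual i) (wI_dual j)]
      exact hr _ _ (w_dual i) (w_dual j) (BB_w i) (BB_w j)
        ⟨_, hi, (mem_eI _ _).2 (Or.inl rfl)⟩ ⟨_, hj, (mem_eI _ _).2 (Or.inl rfl)⟩
    · simpa using hS
  · rintro ⟨T, hT, hadj, rfl⟩
    refine ⟨?_, ?_, ?_⟩
    · rw [Set.ncard_image_of_injective _ eI_inj, Set.ncard_coe_finset, hT]
    · rintro _ ⟨i, -, rfl⟩
      exact (singular_iff _).2 ⟨i, rfl⟩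
    · rintro v v' hv hv' - - ⟨_, ⟨i, hi, rfl⟩, hvi⟩ ⟨_, ⟨j, hj, rfl⟩, hvj⟩
      obtain ⟨a, rfl, ha⟩ := (dual_iff v).1 hv
      obtain ⟨b, rfl, hb⟩ := (dual_iff v').1 hv'
      rw [refl_iff a b ha hb]
      rw [mem_eI] at hvi hvj
      by_cases hij : i = j
      · subst hij
        right
        intro k
        have h2 := beta_self i
        have h4 : (4 : ZMod 3) = 1 := by decide
        rcases hvi with h | h <;> rcases hvj with h' | h' <;>
          rw [h, h'] <;> simp only [beta_neg_left, beta_neg_right, h2, Pi.neg_apply] <;> ring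
      · have hb0 := ((adjI_beta i j).1 (hadj i hi j hj hij)).2
        left
        intro k
        rcases hvi with h | h <;> rcases hvj with h' | h' <;>
          rw [h, h'] <;> simp only [beta_neg_left, beta_neg_right, hb0] <;> ring

theorem adjI_ne (i j : Fin 45) (h : adjI i j = true) : i ≠ j := ((adjI_beta i j).1 h).1

theorem lineI_clique (i j : Fin 45) (h : adjI i j = true) :
    ∀ k ∈ lineI i j, ∀ l ∈ lineI i j, k ≠ l → adjI k l = true := by
  intro k hk l hl hkl
  simp only [lineI, Finset.mem_filter, Finset.mem_univ, true_and] at hk hl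
  rcases hk with rfl | rfl | hk <;> rcases hl with rfl | rfl | hl
  · exact absurd rfl hkl
  · exact h
  · exact hl.1
  · exact adjI_symm _ _ h
  · exact absurd rfl hkl
  · exact hl.2
  · exact adjI_symm _ _ hk.1
  · exact adjI_symm _ _ hk.2
  · exact lineI_clique0 i j h k hk l hl hkl

theorem nStar_eq (i j : Fin 45) (hij : i ≠ j) :
    nStarB {eI i, eI j} = if adjI i j = true then 1 else 0 := by
  unfold nStarB
  split_ifs with h
  · rw [Set.ncard_eq_one]
    refine ⟨eI '' (lineI i j : Set (Fin 45)), ?_⟩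
    ext S
    simp only [Set.mem_ofPred_eq, Set.mem_singleton_iff]
    constructor
    · rintro ⟨hS, hP⟩
      obtain ⟨T, hT, hadj, rfl⟩ := (star_iff S).1 hS
      have hi : i ∈ T := by
        have := hP (Set.mem_insert _ _)
        rwa [eI_inj.mem_set_image] at this
      have hj : j ∈ T := by
        have := hP (Set.mem_insert_of_mem _ rfl)
        rwa [eI_inj.mem_set_image] at this
      have hsub : T ⊆ lineI i j := by
        intro k hk
        simp only [lineI, Finset.mem_filter, Finset.mem_univ, true_and]
        by_cases h1 : k = i
        · exact Or.inl h1
        by_cases h2 : k = j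
        · exact Or.inr (Or.inl h2)
        exact Or.inr (Or.inr ⟨hadj i hi k hk (Ne.symm h1), hadj j hj k hk (Ne.symm h2)⟩)
      rw [Finset.eq_of_subset_of_card_le hsub (by rw [lineI_card i j h, hT])]
    · rintro rfl
      refine ⟨(star_iff _).2 ⟨_, lineI_card i j h, lineI_clique i j h, rfl⟩, ?_⟩
      rintro c (rfl | rfl)
      · exact Set.mem_image_of_mem _ (by simp [lineI])
      · exact Set.mem_image_of_mem _ (by simp [lineI])
  · suffices hE : {S : Set (Sym2 QB) | IsStarSetB S ∧ {eI i, eI j} ⊆ S} = ∅ by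
      rw [hE, Set.ncard_empty]
    rw [Set.eq_empty_iff_forall_notMem]
    rintro S ⟨hS, hP⟩
    obtain ⟨T, hT, hadj, rfl⟩ := (star_iff S).1 hS
    have hi := hP (Set.mem_insert _ _)
    have hj := hP (Set.mem_insert_of_mem _ rfl)
    rw [eI_inj.mem_set_image] at hi hj
    exact h (hadj i hi j hj hij)

theorem pair_iff (P : Set (Sym2 QB)) : IsPairB P ↔ ∃ i j, i < j ∧ P = {eI i, eI j} := by
  constructor
  · rintro ⟨c, d, hc, hd, hne, rfl⟩
    obtain ⟨i, rfl⟩ := (singular_iff c).1 hc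
    obtain ⟨j, rfl⟩ := (singular_iff d).1 hd
    have hij : i ≠ j := fun h => hne (by rw [h])
    rcases lt_or_gt_of_ne hij with h | h
    · exact ⟨i, j, h, rfl⟩
    · exact ⟨j, i, h, Set.pair_comm _ _⟩
  · rintro ⟨i, j, h, rfl⟩
    exact ⟨_, _, (singular_iff _).2 ⟨i, rfl⟩, (singular_iff _).2 ⟨j, rfl⟩,
      fun e => h.ne (eI_inj e), rfl⟩

def pairI (p : Fin 45 × Fin 45) : Set (Sym2 QB) := {eI p.1, eI p.2}

theorem pairI_inj : Set.InjOn pairI {p | p.1 < p.2} := by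
  rintro ⟨i, j⟩ hp ⟨k, l⟩ hq h
  simp only [Set.mem_ofPred_eq] at hp hq
  simp only [pairI, Set.pair_eq_pair_iff, eI_inj.eq_iff] at h
  rcases h with ⟨rfl, rfl⟩ | ⟨rfl, rfl⟩
  · rfl
  · exact absurd hp (not_lt.2 hq.le)

theorem count_gen (Q : Fin 45 × Fin 45 → Prop) [DecidablePred Q] (R : Set (Sym2 QB) → Prop)
    (h : ∀ p : Fin 45 × Fin 45, p.1 < p.2 → (R (pairI p) ↔ Q p)) :
    {P | IsPairB P ∧ R P}.ncard = ((Finset.univ : Finset (Fin 45 × Fin 45)).filter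
      (fun p => p.1 < p.2 ∧ Q p)).card := by
  have e : {P | IsPairB P ∧ R P} = pairI '' (((Finset.univ : Finset (Fin 45 × Fin 45)).filter
      (fun p => p.1 < p.2 ∧ Q p) : Finset _) : Set (Fin 45 × Fin 45)) := by
    ext P
    simp only [Set.mem_ofPred_eq, Set.mem_image, Finset.coe_filter, Finset.mem_univ, true_and]
    constructor
    · rintro ⟨hP, hR⟩
      obtain ⟨i, j, hij, rfl⟩ := (pair_iff P).1 hP
      exact ⟨(i, j), ⟨hij, (h (i, j) hij).1 hR⟩, rfl⟩
    · rintro ⟨p, ⟨hp, hQ⟩, rfl⟩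
      exact ⟨(pair_iff _).2 ⟨_, _, hp, rfl⟩, (h p hp).2 hQ⟩
  rw [e, Set.InjOn.ncard_image, Set.ncard_coe_finset]
  apply pairI_inj.mono
  intro p hp
  simp at hp
  exact hp.1

/-- Among the 990 unordered pairs of distinct singular classes, exactly
720 lie in no `*`-set and the remaining 270 lie in exactly one `*`-set; no pair lies
in more than one `*`-set. -/
theorem statement12 :
    {P : Set (Sym2 QB) | IsPairB P}.ncard = 990 ∧
    {P : Set (Sym2 QB) | IsPairB P ∧ nStarB P = 0}.ncard = 720 ∧
    {P : Set (Sym2 QB) | IsPairB P ∧ nStarB P = 1}.ncard = 270 ∧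
    (∀ P : Set (Sym2 QB), IsPairB P → nStarB P = 0 ∨ nStarB P = 1) := by
  refine ⟨?_, ?_, ?_, ?_⟩
  · have := count_gen (fun _ => True) (fun _ => True) (by simp)
    simp only [and_true] at this
    rw [this]
    exact count_all
  · rw [count_gen (fun p => ¬ adjI p.1 p.2 = true) (fun P => nStarB P = 0)]
    · exact count_nadj
    · intro p hp
      rw [pairI, nStar_eq _ _ hp.ne]
      split_ifs with h <;> simp [h]
  · rw [count_gen (fun p => adjI p.1 p.2 = true) (fun P => nStarB P = 1)]
    · exact count_adj
    · intro p hp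
      rw [pairI, nStar_eq _ _ hp.ne]
      split_ifs with h <;> simp [h]
  · intro P hP
    obtain ⟨i, j, hij, rfl⟩ := (pair_iff P).1 hP
    rw [nStar_eq _ _ hij.ne]
    split_ifs <;> simp

end
end

section
/- In M^∨/M the following counts hold: (i) there are exactly 16 unordered pairs {v+M, −v+M} of cosets of order 6 admitting a representative v with B(v,v) = 1/2; (ii) there are exactly 12 unordered pairs {v+M, −v+M} of cosets of order 3 admitting a representative v with B(v,v) = 2/3; (iii) there is exactly one coset of order 2 admitting a representative v with B(v,v) = 1/2, namely the coset of (0, 0, 1/2, 0, 0). -/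
open Matrix

noncomputable section

/-- Gram matrix of the even lattice `2U(3) ⊕ A₁`. -/
def GramD : Matrix (Fin 5) (Fin 5) ℚ :=
  !![0,0,0,0,3; 0,0,0,3,0; 0,0,2,0,0; 0,3,0,0,0; 3,0,0,0,0]

/-- The bilinear form on `V = ℚ⁵` with Gram matrix `GramD`. -/
def BD (x y : Fin 5 → ℚ) : ℚ := x ⬝ᵥ (GramD).mulVec y

/-- The lattice `M = ℤ⁵ ⊆ ℚ⁵`. -/
def MD : AddSubgroup (Fin 5 → ℚ) where
  carrier := {x | ∀ i, ∃ n : ℤ, x i = (n : ℚ)}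
  zero_mem' := fun i => ⟨0, by simp⟩
  add_mem' := by
    intro a b ha hb i
    obtain ⟨n, hn⟩ := ha i
    obtain ⟨m, hm⟩ := hb i
    exact ⟨n + m, by simp [hn, hm]⟩
  neg_mem' := by
    intro a ha i
    obtain ⟨n, hn⟩ := ha i
    exact ⟨-n, by simp [hn]⟩

/-- The dual lattice `M^∨ = {x ∈ V : B(x,m) ∈ ℤ for all m ∈ M}`. -/
def MDdual : Set (Fin 5 → ℚ) := {x | ∀ m ∈ MD, ∃ n : ℤ, BD x m = (n : ℚ)}

/-- The quotient `V/M` (containing the discriminant group `M^∨/M`). -/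
abbrev QD := (Fin 5 → ℚ) ⧸ MD

/-- The projection `V → V/M`. -/
def pD : (Fin 5 → ℚ) → QD := QuotientAddGroup.mk

/-- Model of the discriminant group. -/
abbrev DD := ZMod 3 × ZMod 3 × ZMod 2 × ZMod 3 × ZMod 3

/-- The dual vector with given integral numerators. -/
def eD (a b c d e : ℤ) : Fin 5 → ℚ := ![a / 3, b / 3, c / 2, d / 3, e / 3]

lemma BD_apply (x y : Fin 5 → ℚ) :
    BD x y = 3 * x 0 * y 4 + 3 * x 1 * y 3 + 2 * x 2 * y 2 + 3 * x 3 * y 1 + 3 * x 4 * y 0 := by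
  simp [BD, GramD, dotProduct, Matrix.mulVec, Fin.sum_univ_five]
  ring

lemma BD_eD (a b c d e : ℤ) :
    BD (eD a b c d e) (eD a b c d e) = ((4 * (a * e + b * d) + 3 * c ^ 2 : ℤ) : ℚ) / 6 := by
  rw [BD_apply]
  simp [eD]
  ring

lemma eD_mem (a b c d e : ℤ) : eD a b c d e ∈ MDdual := by
  intro m hm
  obtain ⟨m0, h0⟩ := hm 0
  obtain ⟨m1, h1⟩ := hm 1
  obtain ⟨m2, h2⟩ := hm 2
  obtain ⟨m3, h3⟩ := hm 3
  obtain ⟨m4, h4⟩ := hm 4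
  refine ⟨a * m4 + b * m3 + c * m2 + d * m1 + e * m0, ?_⟩
  rw [BD_apply, h0, h1, h2, h3, h4]
  simp [eD]
  ring

lemma single_mem_s17 (i : Fin 5) : (Pi.single i 1 : Fin 5 → ℚ) ∈ MD := by
  intro j
  by_cases h : j = i
  · subst h
    exact ⟨1, by simp⟩
  · exact ⟨0, by simp [h]⟩

lemma exists_eD {v : Fin 5 → ℚ} (hv : v ∈ MDdual) : ∃ a b c d e : ℤ, v = eD a b c d e := by
  obtain ⟨e, he⟩ := hv _ (single_mem_s17 0)
  obtain ⟨d, hd⟩ := hv _ (single_mem_s17 1)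
  obtain ⟨c, hc⟩ := hv _ (single_mem_s17 2)
  obtain ⟨b, hb⟩ := hv _ (single_mem_s17 3)
  obtain ⟨a, ha⟩ := hv _ (single_mem_s17 4)
  rw [BD_apply] at ha hb hc hd he
  simp at ha hb hc hd he
  refine ⟨a, b, c, d, e, ?_⟩
  ext i
  fin_cases i <;> simp [eD] <;> linarith

/-- Reduction of the numerators. -/
def castD (a b c d e : ℤ) : DD := (a, b, c, d, e)

lemma int_div_iff (n : ℕ) (hn : (n : ℚ) ≠ 0) (a a' : ℤ) :
    (∃ k : ℤ, -((a : ℚ) / n) + (a' : ℚ) / n = k) ↔ (a : ZMod n) = a' := by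
  rw [ZMod.intCast_eq_intCast_iff_dvd_sub]
  constructor
  · rintro ⟨k, hk⟩
    refine ⟨k, ?_⟩
    field_simp at hk
    have : ((a' - a : ℤ) : ℚ) = ((n * k : ℤ) : ℚ) := by
      push_cast
      linarith
    exact_mod_cast this
  · rintro ⟨k, hk⟩
    refine ⟨k, ?_⟩
    field_simp
    have : ((a' - a : ℤ) : ℚ) = ((n * k : ℤ) : ℚ) := by rw [hk]
    push_cast at this
    linarith

lemma pD_eD_eq (a b c d e a' b' c' d' e' : ℤ) :
    pD (eD a b c d e) = pD (eD a' b' c' d' e') ↔ castD a b c d e = castD a' b' c' d' e' := by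
  have h3 := int_div_iff 3 (by norm_num)
  have h2 := int_div_iff 2 (by norm_num)
  push_cast at h3 h2
  unfold pD
  rw [QuotientAddGroup.eq]
  change (∀ i, ∃ n : ℤ, _ = (n : ℚ)) ↔ _
  simp only [Fin.forall_fin_succ, castD, Prod.mk.injEq, ← h3, ← h2]
  simp [eD]

/-- The embedding of the model into `V/M`, as a function. -/
def gfun (t : DD) : QD :=
  pD (eD t.1.valMinAbs t.2.1.valMinAbs t.2.2.1.valMinAbs t.2.2.2.1.valMinAbs t.2.2.2.2.valMinAbs)

lemma gfun_castD (a b c d e : ℤ) : gfun (castD a b c d e) = pD (eD a b c d e) := by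
  unfold gfun
  rw [pD_eD_eq]
  simp [castD]

lemma exists_castD (t : DD) : ∃ a b c d e : ℤ, t = castD a b c d e :=
  ⟨t.1.valMinAbs, t.2.1.valMinAbs, t.2.2.1.valMinAbs, t.2.2.2.1.valMinAbs,
    t.2.2.2.2.valMinAbs, by simp [castD]⟩

/-- The embedding of the model into `V/M`. -/
def gD : DD →+ QD := AddMonoidHom.mk' gfun (by
  intro s t
  obtain ⟨a, b, c, d, e, rfl⟩ := exists_castD s
  obtain ⟨a', b', c', d', e', rfl⟩ := exists_castD t
  have h1 : castD a b c d e + castD a' b' c' d' e'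
      = castD (a + a') (b + b') (c + c') (d + d') (e + e') := by simp [castD]
  have h2 : eD (a + a') (b + b') (c + c') (d + d') (e + e')
      = eD a b c d e + eD a' b' c' d' e' := by
    ext i
    fin_cases i <;> simp [eD] <;> ring
  rw [h1, gfun_castD, gfun_castD, gfun_castD, h2]
  rfl)

lemma gD_castD (a b c d e : ℤ) : gD (castD a b c d e) = pD (eD a b c d e) :=
  gfun_castD a b c d e

lemma gD_inj : Function.Injective gD := by
  intro s t h
  obtain ⟨a, b, c, d, e, rfl⟩ := exists_castD s
  obtain ⟨a', b', c', d', e', rfl⟩ := exists_castD t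
  rwa [gD_castD, gD_castD, pD_eD_eq] at h

/-- The quadratic form modulo 3. -/
def qD (t : DD) : ZMod 3 := t.1 * t.2.2.2.2 + t.2.1 * t.2.2.2.1

lemma count_aux (n : ℕ) (N : ℤ) (r : ℚ) (hr : r = (N : ℚ) / 6) (F : Finset DD)
    (h1 : ∀ t : DD, addOrderOf t = n → qD t = (N : ZMod 3) → t ∈ F)
    (h2 : ∀ t ∈ F, addOrderOf t = n ∧ ∃ c : ℤ, (c : ZMod 2) = t.2.2.1 ∧
      4 * (t.1.valMinAbs * t.2.2.2.2.valMinAbs + t.2.1.valMinAbs * t.2.2.2.1.valMinAbs)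
        + 3 * c ^ 2 = N) :
    {P : Sym2 QD | ∃ v ∈ MDdual, addOrderOf (pD v) = n ∧ BD v v = r ∧
      P = s(pD v, pD (-v))}.ncard = (F.image (fun t => s(t, -t))).card := by
  have key : {P : Sym2 QD | ∃ v ∈ MDdual, addOrderOf (pD v) = n ∧ BD v v = r ∧
      P = s(pD v, pD (-v))} = Sym2.map gD '' (F.image (fun t => s(t, -t)) : Finset (Sym2 DD)) := by
    ext P
    simp only [Set.mem_ofPred_eq, Finset.coe_image, Set.mem_image, Finset.mem_coe,
      exists_exists_and_eq_and, Sym2.map_mk, map_neg]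
    constructor
    · rintro ⟨v, hv, ho, hB, rfl⟩
      obtain ⟨a, b, c, d, e, rfl⟩ := exists_eD hv
      rw [← gD_castD, addOrderOf_injective gD gD_inj] at ho
      refine ⟨castD a b c d e, h1 _ ho ?_, ?_⟩
      · rw [BD_eD, hr] at hB
        have h : 4 * (a * e + b * d) + 3 * c ^ 2 = N := by
          have : ((4 * (a * e + b * d) + 3 * c ^ 2 : ℤ) : ℚ) = N := by linarith
          exact_mod_cast this
        rw [← h]
        have h4 : (4 : ZMod 3) = 1 := by decide
        have h3 : (3 : ZMod 3) = 0 := by decide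
        push_cast
        rw [h4, h3]
        simp [qD, castD]
      · rw [gD_castD]
        rfl
    · rintro ⟨t, ht, rfl⟩
      obtain ⟨ho, c, hc, hN⟩ := h2 t ht
      have e1 : t = castD t.1.valMinAbs t.2.1.valMinAbs c t.2.2.2.1.valMinAbs
          t.2.2.2.2.valMinAbs := by simp [castD, hc]
      have e2 := congrArg gD e1
      rw [gD_castD] at e2
      refine ⟨_, eD_mem t.1.valMinAbs t.2.1.valMinAbs c t.2.2.2.1.valMinAbs
        t.2.2.2.2.valMinAbs, ?_, ?_, ?_⟩
      · rw [← e2, addOrderOf_injective gD gD_inj, ho]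
      · rw [BD_eD, hN, hr]
      · rw [e2]
        rfl
  rw [key, Set.ncard_image_of_injective _ (Sym2.map.injective gD_inj), Set.ncard_coe_finset]

/-- Nonzero isotropic classes of order 6. -/
def F6 : Finset DD := Finset.univ.filter fun t =>
  t.2.2.1 = 1 ∧ (t.1, t.2.1, t.2.2.2) ≠ 0 ∧ qD t = 0

/-- Classes of order 3 and norm 2/3. -/
def F3 : Finset DD := Finset.univ.filter fun t => t.2.2.1 = 0 ∧ qD t = 1

lemma F6_card : (F6.image (fun t => s(t, -t))).card = 16 := by decide +kernel

lemma F3_card : (F3.image (fun t => s(t, -t))).card = 12 := by decide +kernel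

set_option synthInstance.maxHeartbeats 400000 in
set_option synthInstance.maxSize 2000 in
lemma F6_mem : ∀ t : DD, addOrderOf t = 6 → qD t = ((3 : ℤ) : ZMod 3) → t ∈ F6 := by
  simp only [addOrderOf_eq_iff (show 0 < 6 by norm_num)]
  decide +kernel

set_option synthInstance.maxHeartbeats 400000 in
set_option synthInstance.maxSize 2000 in
lemma F3_mem : ∀ t : DD, addOrderOf t = 3 → qD t = ((4 : ℤ) : ZMod 3) → t ∈ F3 := by
  simp only [addOrderOf_eq_iff (show 0 < 3 by norm_num)]
  decide +kernel

lemma F6_ord : ∀ t ∈ F6, addOrderOf t = 6 := by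
  simp only [addOrderOf_eq_iff (show 0 < 6 by norm_num)]
  decide +kernel

lemma F3_ord : ∀ t ∈ F3, addOrderOf t = 3 := by
  simp only [addOrderOf_eq_iff (show 0 < 3 by norm_num)]
  decide +kernel

lemma F6_lift : ∀ t ∈ F6, ((1 : ℤ) : ZMod 2) = t.2.2.1 ∧
      4 * (t.1.valMinAbs * t.2.2.2.2.valMinAbs + t.2.1.valMinAbs * t.2.2.2.1.valMinAbs)
        + 3 * (1 : ℤ) ^ 2 = 3 := by
  decide +kernel

lemma F3_lift : ∀ t ∈ F3, ∃ k : Fin 3, (((k.val : ℤ)) : ZMod 2) = t.2.2.1 ∧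
      4 * (t.1.valMinAbs * t.2.2.2.2.valMinAbs + t.2.1.valMinAbs * t.2.2.2.1.valMinAbs)
        + 3 * (k.val : ℤ) ^ 2 = 4 := by
  decide +kernel

set_option synthInstance.maxHeartbeats 400000 in
set_option synthInstance.maxSize 2000 in
lemma ord_two : ∀ t : DD, addOrderOf t = 2 ↔ t = (0, 0, 1, 0, 0) := by
  simp only [addOrderOf_eq_iff (show 0 < 2 by norm_num)]
  decide +kernel

lemma half_eq : (![0, 0, 1/2, 0, 0] : Fin 5 → ℚ) = eD 0 0 1 0 0 := by simp [eD]

/-- In `M^∨/M` there are exactly 16 unordered pairs `{v+M, −v+M}` of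
cosets of order 6 admitting a representative with `B(v,v) = 1/2`; exactly 12
unordered pairs `{v+M, −v+M}` of cosets of order 3 admitting a representative with
`B(v,v) = 2/3`; and exactly one coset of order 2 admitting a representative with
`B(v,v) = 1/2`, namely the coset of `(0, 0, 1/2, 0, 0)`. -/
theorem statement17 :
    {P : Sym2 QD | ∃ v ∈ MDdual, addOrderOf (pD v) = 6 ∧ BD v v = 1/2 ∧
      P = s(pD v, pD (-v))}.ncard = 16 ∧
    {P : Sym2 QD | ∃ v ∈ MDdual, addOrderOf (pD v) = 3 ∧ BD v v = 2/3 ∧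
      P = s(pD v, pD (-v))}.ncard = 12 ∧
    {c : QD | ∃ v ∈ MDdual, pD v = c ∧ addOrderOf c = 2 ∧ BD v v = 1/2} =
      {pD ![0, 0, 1/2, 0, 0]} := by
  refine ⟨?_, ?_, ?_⟩
  · rw [count_aux 6 3 (1/2) (by norm_num) F6 F6_mem
      (fun t ht => ⟨F6_ord t ht, 1, F6_lift t ht⟩), F6_card]
  · rw [count_aux 3 4 (2/3) (by norm_num) F3 F3_mem
      (fun t ht => ⟨F3_ord t ht, (F3_lift t ht).elim fun k hk => ⟨_, hk⟩⟩), F3_card]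
  · rw [half_eq]
    ext x
    simp only [Set.mem_ofPred_eq, Set.mem_singleton_iff]
    constructor
    · rintro ⟨v, hv, rfl, ho, -⟩
      obtain ⟨a, b, c, d, e, rfl⟩ := exists_eD hv
      rw [← gD_castD, addOrderOf_injective gD gD_inj, ord_two] at ho
      rw [pD_eD_eq, ho]
      simp [castD]
    · rintro rfl
      refine ⟨_, eD_mem 0 0 1 0 0, rfl, ?_, ?_⟩
      · rw [← gD_castD, addOrderOf_injective gD gD_inj, ord_two]
        simp [castD]
      · rw [BD_eD]
        norm_num

end
end
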